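/- Let f : (-1,1) → ℝ be measurable with f(x)·(1-x²)^{1/4} ∈ L²(-1,1). If the finite Hilbert transform (Hf)(x) vanishes for almost every x ∈ (-1,1), then the function x ↦ f(x)·√(1-x²) is almost everywhere equal to a constant on (-1,1). -/

import Mathlib

open MeasureTheory Filter Set Real

/-- The truncated finite Hilbert transform of `f` on `(-1,1)` at `x`. -/
noncomputable def truncatedFiniteHilbert (f : ℝ → ℝ) (x ε : ℝ) : ℝ :=
  (1 / π) * ∫ y in Ioo (-1 : ℝ) 1 \ Ioo (x - ε) (x + ε), f y / (x - y)

/-- `L` is the value of the finite Hilbert transform at `x`, as a limit as `ε → 0⁺`. -/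
def HasFiniteHilbertAt (f : ℝ → ℝ) (x L : ℝ) : Prop :=
  Tendsto (fun ε => truncatedFiniteHilbert f x ε) (nhdsWithin 0 (Ioi 0)) (nhds L)

theorem hasSum_integral_mul_of_bounded {α : Type*} [MeasurableSpace α] {ν : Measure α}
    [IsFiniteMeasure ν] {e : ℕ → α → ℝ} (hem : ∀ n, Measurable (e n))
    (he : ∀ n x, |e n x| ≤ 1) {b : ℕ → ℝ} (hb : Summable fun n => |b n|)
    {φ : α → ℝ} (hφ : AEStronglyMeasurable φ ν) {K : ℝ} (hK : ∀ x, |φ x| ≤ K) :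
    HasSum (fun n => b n * ∫ x, e n x * φ x ∂ν) (∫ x, (∑' n, b n * e n x) * φ x ∂ν) := by
  have hbd : ∀ n x, ‖b n * (e n x * φ x)‖ ≤ |b n| * K := by
    intro n x
    rw [norm_mul, norm_mul, Real.norm_eq_abs, Real.norm_eq_abs, Real.norm_eq_abs]
    have h1 := he n x
    have h2 := hK x
    have : |e n x| * |φ x| ≤ 1 * K :=
      mul_le_mul h1 h2 (abs_nonneg _) zero_le_one
    rw [one_mul] at this
    exact mul_le_mul_of_nonneg_left this (abs_nonneg _)
  have hsum : ∀ x, Summable fun n => b n * e n x := fun x =>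
    Summable.of_norm_bounded hb fun n => by
      rw [norm_mul, Real.norm_eq_abs, Real.norm_eq_abs]
      exact mul_le_of_le_one_right (abs_nonneg _) (he n x)
  have := hasSum_integral_of_dominated_convergence (μ := ν)
    (F := fun n x => b n * (e n x * φ x)) (f := fun x => (∑' n, b n * e n x) * φ x)
    (fun n _ => |b n| * K)
    (fun n => ((hem n).aestronglyMeasurable.mul hφ).const_mul _)
    (fun n => Eventually.of_forall (hbd n))
    (Eventually.of_forall fun _ => hb.mul_right K) (integrable_const _)
    (Eventually.of_forall fun x => by
      simpa only [mul_assoc] using (hsum x).hasSum.mul_right (φ x))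
  simpa only [integral_const_mul] using this

/-- A family bounded in `L²` of a finite measure and tending to zero almost everywhere tends to
zero in `L¹`. -/
theorem tendsto_integral_abs_of_sq_bounded {α ι : Type*} [MeasurableSpace α] {ν : Measure α}
    [IsFiniteMeasure ν] {l : Filter ι} [l.IsCountablyGenerated] {S : ι → α → ℝ} {C : ℝ}
    (hS : ∀ᶠ i in l, MemLp (S i) 2 ν) (hC : ∀ᶠ i in l, ∫ x, S i x ^ 2 ∂ν ≤ C)
    (hlim : ∀ᵐ x ∂ν, Tendsto (fun i => S i x) l (nhds 0)) :
    Tendsto (fun i => ∫ x, |S i x| ∂ν) l (nhds 0) := by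
  have hC0 : 0 ≤ |C| := abs_nonneg C
  rw [Metric.tendsto_nhds]
  intro δ hδ
  set R : ℝ := 2 * (|C| + 1) / δ with hR
  have hRpos : 0 < R := by positivity
  have hmin : Tendsto (fun i => ∫ x, min |S i x| R ∂ν) l (nhds (∫ _, (0 : ℝ) ∂ν)) := by
    refine tendsto_integral_filter_of_dominated_convergence (fun _ => R) ?_ ?_
      (integrable_const _) ?_
    · filter_upwards [hS] with i hi
      exact (hi.aestronglyMeasurable.norm.inf aestronglyMeasurable_const)
    · refine Eventually.of_forall fun i => Eventually.of_forall fun x => ?_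
      rw [Real.norm_eq_abs, abs_of_nonneg (le_min (abs_nonneg _) hRpos.le)]
      exact min_le_right _ _
    · filter_upwards [hlim] with x hx
      have := (hx.abs).min (tendsto_const_nhds (x := R))
      simpa [abs_zero, min_eq_left hRpos.le] using this
  rw [integral_zero, Metric.tendsto_nhds] at hmin
  filter_upwards [hmin (δ / 2) (by positivity), hS, hC] with i h1 h2 h3
  have hint : Integrable (fun x => |S i x|) ν := (h2.integrable (by norm_num)).abs
  have hsq : Integrable (fun x => S i x ^ 2) ν := h2.integrable_sq
  have hmi : Integrable (fun x => min |S i x| R) ν := hint.inf (integrable_const R)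
  have hle : ∫ x, |S i x| ∂ν ≤ ∫ x, (min |S i x| R + S i x ^ 2 / R) ∂ν := by
    refine integral_mono hint (hmi.add (hsq.div_const R)) fun x => ?_
    dsimp only
    rcases le_total |S i x| R with h | h
    · rw [min_eq_left h]
      have : 0 ≤ S i x ^ 2 / R := by positivity
      linarith
    · rw [min_eq_right h]
      have : |S i x| ≤ S i x ^ 2 / R := by
        rw [le_div_iff₀ hRpos, ← sq_abs]
        nlinarith [abs_nonneg (S i x)]
      linarith
  rw [integral_add hmi (hsq.div_const R), integral_div] at hle
  rw [Real.dist_eq, sub_zero] at h1 ⊢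
  rw [abs_of_nonneg (integral_nonneg fun x => abs_nonneg _)]
  have h4 : (∫ x, S i x ^ 2 ∂ν) / R < δ / 2 := by
    rw [div_lt_iff₀ hRpos, hR]
    have : δ / 2 * (2 * (|C| + 1) / δ) = |C| + 1 := by field_simp
    rw [this]
    linarith [le_abs_self C]
  linarith [le_abs_self (∫ x, min |S i x| R ∂ν)]

/-- If the Abel means of a square-summable orthogonal expansion tend to zero almost everywhere,
then all coefficients vanish. -/
theorem coeff_eq_zero_of_ae_tendsto_abel {α ι : Type*} [MeasurableSpace α] {ν : Measure α}
    [IsFiniteMeasure ν] {l : Filter ι} [l.IsCountablyGenerated] [l.NeBot]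
    {e : ℕ → α → ℝ} (hem : ∀ n, Measurable (e n)) (he : ∀ n x, |e n x| ≤ 1)
    {κ : ℝ} (hκ : 0 < κ) (horth : ∀ n m, ∫ x, e n x * e m x ∂ν = if n = m then κ else 0)
    {a : ℕ → ℝ} {B : ℝ} (hB : ∀ N, ∑ n ∈ Finset.range N, a n ^ 2 ≤ B)
    {r : ι → ℝ} (hr0 : ∀ i, 0 ≤ r i) (hr1 : ∀ᶠ i in l, r i < 1) (hr : Tendsto r l (nhds 1))
    (hlim : ∀ᵐ x ∂ν, Tendsto (fun i => ∑' n, (r i ^ n * a n) * e n x) l (nhds 0)) (n : ℕ) :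
    a n = 0 := by
  have ha : ∀ n, |a n| ≤ √B := fun n => by
    refine Real.abs_le_sqrt ((Finset.single_le_sum (f := fun n => a n ^ 2)
      (fun i _ => sq_nonneg _) (Finset.self_mem_range_succ n)).trans (hB (n + 1)))
  have hsum : ∀ i, r i < 1 → Summable fun n => |r i ^ n * a n| := fun i hi => by
    refine Summable.of_nonneg_of_le (fun _ => abs_nonneg _) (fun n => ?_)
      ((summable_geometric_of_lt_one (hr0 i) hi).mul_right √B)
    rw [abs_mul, abs_of_nonneg (pow_nonneg (hr0 i) n)]
    exact mul_le_mul_of_nonneg_left (ha n) (pow_nonneg (hr0 i) n)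
  set S : ι → α → ℝ := fun i x => ∑' n, (r i ^ n * a n) * e n x with hSdef
  have hSm : ∀ i, Measurable (S i) := fun i =>
    Measurable.tsum fun n => (hem n).const_mul _
  have hSb : ∀ i, r i < 1 → ∀ x, |S i x| ≤ ∑' n, |r i ^ n * a n| := fun i hi x => by
    rw [← Real.norm_eq_abs]
    refine tsum_of_norm_bounded (hsum i hi).hasSum fun n => ?_
    rw [norm_mul, Real.norm_eq_abs, Real.norm_eq_abs]
    exact mul_le_of_le_one_right (abs_nonneg _) (he n x)
  have hcoef : ∀ i, r i < 1 → ∀ m, ∫ x, S i x * e m x ∂ν = κ * (r i ^ m * a m) := by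
    intro i hi m
    have h := hasSum_integral_mul_of_bounded (ν := ν) hem he (hsum i hi)
      (hem m).aestronglyMeasurable (he m)
    rw [← h.tsum_eq, tsum_eq_single m]
    · rw [horth, if_pos rfl, mul_comm]
    · intro k hk
      rw [horth, if_neg hk, mul_zero]
  have hsq : ∀ i, r i < 1 → ∫ x, S i x ^ 2 ∂ν ≤ κ * B := by
    intro i hi
    have h := hasSum_integral_mul_of_bounded (ν := ν) hem he (hsum i hi)
      (hSm i).aestronglyMeasurable (hSb i hi)
    have h2 : ∫ x, S i x ^ 2 ∂ν = ∫ x, (∑' n, (r i ^ n * a n) * e n x) * S i x ∂ν := by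
      simp only [sq, hSdef]
    rw [h2]
    refine le_of_tendsto h.tendsto_sum_nat (Eventually.of_forall fun N => ?_)
    have : ∀ n ∈ Finset.range N, (r i ^ n * a n) * ∫ x, e n x * S i x ∂ν ≤ κ * a n ^ 2 := by
      intro n _
      have h3 : ∫ x, e n x * S i x ∂ν = κ * (r i ^ n * a n) := by
        rw [← hcoef i hi n]; simp only [mul_comm]
      rw [h3]
      have h4 : (r i ^ n) ^ 2 ≤ 1 :=
        pow_le_one₀ (pow_nonneg (hr0 i) n) (pow_le_one₀ (hr0 i) hi.le)
      have h5 : 0 ≤ κ * a n ^ 2 := by positivity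
      nlinarith
    refine (Finset.sum_le_sum this).trans ?_
    rw [← Finset.mul_sum]
    exact mul_le_mul_of_nonneg_left (hB N) hκ.le
  have habs : Tendsto (fun i => ∫ x, |S i x| ∂ν) l (nhds 0) := by
    refine tendsto_integral_abs_of_sq_bounded (C := κ * B) ?_ (hr1.mono hsq) hlim
    filter_upwards [hr1] with i hi
    exact MemLp.of_bound (hSm i).aestronglyMeasurable _ (Eventually.of_forall (hSb i hi))
  have hzero : Tendsto (fun i => κ * (r i ^ n * a n)) l (nhds 0) := by
    refine squeeze_zero_norm' ?_ habs
    filter_upwards [hr1] with i hi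
    rw [← hcoef i hi n]
    refine (norm_integral_le_integral_norm _).trans ?_
    have hSi : Integrable (S i) ν :=
      Integrable.of_bound (hSm i).aestronglyMeasurable _ (Eventually.of_forall (hSb i hi))
    refine integral_mono_of_nonneg (Eventually.of_forall fun _ => norm_nonneg _) hSi.abs
      (Eventually.of_forall fun x => ?_)
    dsimp only
    rw [norm_mul, Real.norm_eq_abs, Real.norm_eq_abs]
    exact mul_le_of_le_one_right (abs_nonneg _) (he n x)
  have hone : Tendsto (fun i => κ * (r i ^ n * a n)) l (nhds (κ * (1 ^ n * a n))) :=
    ((hr.pow n).mul_const _).const_mul _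
  have := tendsto_nhds_unique hone hzero
  rw [one_pow, one_mul] at this
  exact (mul_eq_zero.mp this).resolve_left hκ.ne'

theorem integral_Ioi_truncation_weight {A : ℝ} (hA : 0 ≤ A) :
    ∫ v in Ioi (0 : ℝ), (if v ≤ A then 2 * v / (1 + v ^ 2) ^ 2 else 0) = A ^ 2 / (1 + A ^ 2) := by
  have h1 : (fun v : ℝ => if v ≤ A then 2 * v / (1 + v ^ 2) ^ 2 else 0)
      = (Iic A).indicator fun v => 2 * v / (1 + v ^ 2) ^ 2 := by
    ext v; simp [indicator_apply]
  rw [h1, setIntegral_indicator measurableSet_Iic, Ioi_inter_Iic,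
    ← intervalIntegral.integral_of_le hA]
  have hder : ∀ v ∈ uIcc 0 A,
      HasDerivAt (fun v : ℝ => v ^ 2 / (1 + v ^ 2)) (2 * v / (1 + v ^ 2) ^ 2) v := by
    intro v _
    have hne : (1 + v ^ 2) ≠ 0 := by positivity
    have h2 : HasDerivAt (fun v : ℝ => v ^ 2) (2 * v) v := by simpa using hasDerivAt_pow 2 v
    convert! h2.div (h2.const_add 1) hne using 1
    ring
  rw [intervalIntegral.integral_eq_sub_of_hasDerivAt hder]
  · simp
  · refine Continuous.intervalIntegrable ?_ _ _
    refine Continuous.div (by fun_prop) (by fun_prop) fun v => ?_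
    positivity

theorem truncation_weight_le (v : ℝ) : 2 * v / (1 + v ^ 2) ^ 2 ≤ (1 + v ^ 2)⁻¹ := by
  have h : 0 < 1 + v ^ 2 := by positivity
  rw [div_le_iff₀ (by positivity)]
  have : (1 + v ^ 2)⁻¹ * (1 + v ^ 2) ^ 2 = 1 + v ^ 2 := by field_simp
  rw [this]
  nlinarith [sq_nonneg (v - 1)]

/-- The smoothed kernel `t / (t ^ 2 + h ^ 2)` is an average of truncated kernels `1 / t`. -/
theorem integral_smoothed_kernel_eq {f : ℝ → ℝ} (hf : IntegrableOn f (Ioo (-1 : ℝ) 1))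
    (x : ℝ) {h : ℝ} (hh : 0 < h) :
    IntegrableOn (fun v => 2 * v / (1 + v ^ 2) ^ 2 *
        ∫ y in Ioo (-1 : ℝ) 1 \ Ioo (x - h * v) (x + h * v), f y / (x - y)) (Ioi 0) ∧
    ∫ y in Ioo (-1 : ℝ) 1, f y * ((y - x) / ((y - x) ^ 2 + h ^ 2)) =
      -∫ v in Ioi (0 : ℝ), 2 * v / (1 + v ^ 2) ^ 2 *
        ∫ y in Ioo (-1 : ℝ) 1 \ Ioo (x - h * v) (x + h * v), f y / (x - y) := by
  set μ := volume.restrict (Ioo (-1 : ℝ) 1) with hμ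
  set τ := volume.restrict (Ioi (0 : ℝ)) with hτ
  set Φ : ℝ → ℝ → ℝ := fun y v =>
    f y / (x - y) * (if v ≤ |y - x| / h then 2 * v / (1 + v ^ 2) ^ 2 else 0) with hΦ
  have hmeas : AEStronglyMeasurable (Function.uncurry Φ) (μ.prod τ) := by
    have h1 : AEStronglyMeasurable (fun p : ℝ × ℝ => f p.1) (μ.prod τ) :=
      hf.aestronglyMeasurable.comp_fst
    have h2 : Measurable (fun p : ℝ × ℝ => (x - p.1)⁻¹) := by fun_prop
    have h3 : Measurable (fun p : ℝ × ℝ =>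
        if p.2 ≤ |p.1 - x| / h then 2 * p.2 / (1 + p.2 ^ 2) ^ 2 else 0) := by
      refine Measurable.ite (measurableSet_le (by fun_prop) ?_) (by fun_prop) measurable_const
      exact ((measurable_fst.sub_const x).abs).div_const h
    exact (h1.mul h2.aestronglyMeasurable).mul h3.aestronglyMeasurable
  have hbound : Integrable (fun p : ℝ × ℝ => f p.1 * (2 / h * (1 + p.2 ^ 2)⁻¹)) (μ.prod τ) :=
    Integrable.mul_prod hf ((integrable_inv_one_add_sq.integrableOn).const_mul (2 / h))
  have hint : Integrable (Function.uncurry Φ) (μ.prod τ) := by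
    refine hbound.mono hmeas ?_
    have hpos : ∀ᵐ p ∂(μ.prod τ), 0 < p.2 :=
      Measure.quasiMeasurePreserving_snd.ae (p := fun v : ℝ => 0 < v)
        (ae_restrict_mem measurableSet_Ioi)
    filter_upwards [hpos] with p hp
    obtain ⟨y, v⟩ := p
    dsimp only at hp
    simp only [Function.uncurry, hΦ]
    rw [norm_mul, norm_mul, norm_div, div_mul_eq_mul_div, mul_div_assoc]
    refine mul_le_mul_of_nonneg_left ?_ (norm_nonneg _)
    have hq : 0 < 1 + v ^ 2 := by positivity
    rw [Real.norm_of_nonneg (by positivity : 0 ≤ 2 / h * (1 + v ^ 2)⁻¹)]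
    split_ifs with hc
    · have ht : h * v ≤ |y - x| := by rwa [le_div_iff₀ hh, mul_comm] at hc
      have ht' : h * v ≤ ‖x - y‖ := by rwa [Real.norm_eq_abs, abs_sub_comm]
      have hhv : 0 < h * v := by positivity
      rw [Real.norm_of_nonneg (by positivity)]
      calc 2 * v / (1 + v ^ 2) ^ 2 / ‖x - y‖ ≤ 2 * v / (1 + v ^ 2) ^ 2 / (h * v) :=
            div_le_div_of_nonneg_left (by positivity) hhv ht'
        _ = 2 / h * (1 + v ^ 2)⁻¹ * (1 + v ^ 2)⁻¹ := by field_simp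
        _ ≤ 2 / h * (1 + v ^ 2)⁻¹ * 1 := by
            refine mul_le_mul_of_nonneg_left (inv_le_one_of_one_le₀ ?_) (by positivity)
            nlinarith [sq_nonneg v]
        _ = _ := mul_one _
    · simp only [norm_zero, zero_div]; positivity
  have hinner : ∀ v ∈ Ioi (0 : ℝ), ∫ y, Φ y v ∂μ = 2 * v / (1 + v ^ 2) ^ 2 *
      ∫ y in Ioo (-1 : ℝ) 1 \ Ioo (x - h * v) (x + h * v), f y / (x - y) := by
    intro v _
    have h1 : (fun y => Φ y v) = fun y => 2 * v / (1 + v ^ 2) ^ 2 *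
        ((Ioo (x - h * v) (x + h * v))ᶜ).indicator (fun y => f y / (x - y)) y := by
      ext y
      have hiff : y ∈ (Ioo (x - h * v) (x + h * v))ᶜ ↔ v ≤ |y - x| / h := by
        rw [le_div_iff₀ hh, ← Real.ball_eq_Ioo, mem_compl_iff, Metric.mem_ball, not_lt,
          Real.dist_eq, mul_comm]
      simp only [hΦ, indicator_apply, hiff]
      split_ifs
      · ring
      · ring
    rw [h1, integral_const_mul, hμ, setIntegral_indicator measurableSet_Ioo.compl]
    rfl
  have hswap := integral_integral_swap hint
  have hright := hint.integral_prod_right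
  constructor
  · refine hright.congr ?_
    filter_upwards [ae_restrict_mem measurableSet_Ioi] with v hv using hinner v hv
  · rw [← setIntegral_congr_fun measurableSet_Ioi hinner, ← hswap, ← integral_neg]
    refine integral_congr_ae (Eventually.of_forall fun y => ?_)
    simp only [hΦ]
    rw [integral_const_mul, integral_Ioi_truncation_weight (by positivity)]
    rcases eq_or_ne x y with rfl | hne
    · simp
    · have h1 : x - y ≠ 0 := sub_ne_zero.mpr hne
      have h2 : (y - x) ^ 2 + h ^ 2 ≠ 0 := by positivity
      have h3 : 1 + (|y - x| / h) ^ 2 = ((y - x) ^ 2 + h ^ 2) / h ^ 2 := by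
        rw [div_pow, sq_abs]; field_simp; ring
      rw [h3, div_pow, sq_abs]
      field_simp
      ring

theorem tendsto_integral_smoothed_kernel {f : ℝ → ℝ} (hf : IntegrableOn f (Ioo (-1 : ℝ) 1))
    {x : ℝ} (hx : HasFiniteHilbertAt f x 0) :
    Tendsto (fun h => ∫ y in Ioo (-1 : ℝ) 1, f y * ((y - x) / ((y - x) ^ 2 + h ^ 2)))
      (nhdsWithin 0 (Ioi 0)) (nhds 0) := by
  set T : ℝ → ℝ := fun s => ∫ y in Ioo (-1 : ℝ) 1 \ Ioo (x - s) (x + s), f y / (x - y) with hT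
  have hT0 : Tendsto T (nhdsWithin 0 (Ioi 0)) (nhds 0) := by
    have := Tendsto.const_mul π hx
    rw [mul_zero] at this
    refine this.congr fun s => ?_
    simp only [truncatedFiniteHilbert, hT]
    field_simp
  obtain ⟨M, hM⟩ : ∃ M, ∀ s > 0, |T s| ≤ M := by
    have h1 : ∀ᶠ s in nhdsWithin 0 (Ioi 0), |T s| < 1 := by
      have := hT0.abs
      rw [abs_zero] at this
      exact this.eventually_lt_const one_pos
    obtain ⟨δ, hδ, hδT⟩ := mem_nhdsGT_iff_exists_Ioo_subset.mp h1
    rw [mem_Ioi] at hδ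
    refine ⟨max 1 ((∫ y in Ioo (-1 : ℝ) 1, |f y|) / δ), fun s hs => ?_⟩
    rcases lt_or_ge s δ with h | h
    · exact (hδT ⟨hs, h⟩ : |T s| < 1).le.trans (le_max_left _ _)
    · refine le_trans ?_ (le_max_right _ _)
      rw [← integral_div]
      refine (abs_integral_le_integral_abs).trans ?_
      have hsub : Ioo (-1 : ℝ) 1 \ Ioo (x - s) (x + s) ⊆ Ioo (-1) 1 := sdiff_subset
      have hfi : IntegrableOn (fun y => |f y| / δ) (Ioo (-1 : ℝ) 1) := hf.abs.div_const δ
      refine le_trans (integral_mono_of_nonneg (Eventually.of_forall fun _ => abs_nonneg _)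
        (hfi.mono_set hsub) ?_) (setIntegral_mono_set hfi
          (Eventually.of_forall fun y => by positivity) hsub.eventuallyLE)
      filter_upwards [ae_restrict_mem (measurableSet_Ioo.diff measurableSet_Ioo)] with y hy
      rw [abs_div]
      refine div_le_div_of_nonneg_left (abs_nonneg _) hδ (h.trans ?_)
      have := hy.2
      rw [← Real.ball_eq_Ioo, Metric.mem_ball, not_lt, Real.dist_eq, abs_sub_comm] at this
      exact this
  have hlim : Tendsto (fun h => ∫ v in Ioi (0 : ℝ), 2 * v / (1 + v ^ 2) ^ 2 * T (h * v))
      (nhdsWithin 0 (Ioi 0)) (nhds (∫ _ in Ioi (0 : ℝ), (0 : ℝ))) := by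
    refine tendsto_integral_filter_of_dominated_convergence (fun v => (1 + v ^ 2)⁻¹ * M) ?_ ?_
      (integrable_inv_one_add_sq.integrableOn.mul_const M) ?_
    · filter_upwards [self_mem_nhdsWithin] with h hh
      exact (integral_smoothed_kernel_eq hf x hh).1.aestronglyMeasurable
    · filter_upwards [self_mem_nhdsWithin] with h hh
      filter_upwards [ae_restrict_mem measurableSet_Ioi] with v hv
      rw [mem_Ioi] at hh hv
      rw [norm_mul, Real.norm_of_nonneg (by positivity)]
      exact mul_le_mul (truncation_weight_le v) (hM _ (by positivity)) (norm_nonneg _)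
        (by positivity)
    · filter_upwards [ae_restrict_mem measurableSet_Ioi] with v hv
      rw [mem_Ioi] at hv
      have h1 : Tendsto (fun h : ℝ => h * v) (nhdsWithin 0 (Ioi 0)) (nhdsWithin 0 (Ioi 0)) := by
        refine tendsto_nhdsWithin_of_tendsto_nhds_of_eventually_within _ ?_ ?_
        · have : Tendsto (fun h : ℝ => h * v) (nhds 0) (nhds (0 * v)) :=
            (continuous_mul_const v).tendsto 0
          rw [zero_mul] at this
          exact this.mono_left nhdsWithin_le_nhds
        · filter_upwards [self_mem_nhdsWithin] with h hh
          exact mul_pos hh hv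
      have := (hT0.comp h1).const_mul (2 * v / (1 + v ^ 2) ^ 2)
      rwa [mul_zero] at this
  have := hlim.neg
  rw [integral_zero, neg_zero] at this
  refine this.congr' ?_
  filter_upwards [self_mem_nhdsWithin] with h hh
  exact (integral_smoothed_kernel_eq hf x hh).2.symm

/-- On the circle of radius `r = √(1 + η ^ 2) - η`, the conjugate Poisson kernel in the
variables `x = cos θ`, `y = cos φ`, up to the factor `sin θ`. -/
noncomputable def conjKernel (x η y : ℝ) : ℝ :=
  (√(1 + η ^ 2) * y - x) / ((y - √(1 + η ^ 2) * x) ^ 2 + η ^ 2 * (1 - x ^ 2))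

theorem abs_conjKernel_sub_le {x η y : ℝ} (hx : x ∈ Ioo (-1 : ℝ) 1) (hy : y ∈ Ioo (-1 : ℝ) 1)
    (hη : 0 < η) :
    |conjKernel x η y - (y - x) / ((y - x) ^ 2 + (η * √(1 - x ^ 2)) ^ 2)| ≤
      3 * (1 - x ^ 2)⁻¹ + 2 * ((1 - x ^ 2)⁻¹) ^ 2 := by
  have hw : 0 < 1 - x ^ 2 := by nlinarith [hx.1, hx.2]
  rw [mul_pow, Real.sq_sqrt hw.le, conjKernel]
  set W := 1 - x ^ 2 with hW
  set ε := √(1 + η ^ 2) - 1 with hε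
  have hs : √(1 + η ^ 2) = 1 + ε := by rw [hε]; ring
  have hε0 : 0 ≤ ε := by
    rw [hε, sub_nonneg]; exact Real.one_le_sqrt.mpr (by nlinarith [sq_nonneg η])
  have hε1 : ε ≤ η ^ 2 := by
    have : (1 + ε) ^ 2 = 1 + η ^ 2 := by rw [← hs, Real.sq_sqrt (by positivity)]
    nlinarith
  rw [hs]
  set h2 := η ^ 2 * W with hh2
  have hh2pos : 0 < h2 := by positivity
  set t := y - x with ht
  set q := ε / h2 with hq
  have hq0 : 0 ≤ q := by positivity
  have hq1 : q ≤ W⁻¹ := by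
    rw [hq, div_le_iff₀ hh2pos, hh2]
    have : W⁻¹ * (η ^ 2 * W) = η ^ 2 := by field_simp
    rw [this]; exact hε1
  set D := (y - (1 + ε) * x) ^ 2 + h2 with hD
  set D0 := t ^ 2 + h2 with hD0
  have hDge : h2 ≤ D := by rw [hD]; nlinarith [sq_nonneg (y - (1 + ε) * x)]
  have hD0ge : h2 ≤ D0 := by rw [hD0]; nlinarith [sq_nonneg t]
  have hDpos : 0 < D := hh2pos.trans_le hDge
  have hD0pos : 0 < D0 := hh2pos.trans_le hD0ge
  have hqD : ε / D ≤ q := div_le_div_of_nonneg_left hε0 hh2pos hDge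
  have hqD0 : ε / D0 ≤ q := div_le_div_of_nonneg_left hε0 hh2pos hD0ge
  have hqD' : 0 ≤ ε / D := by positivity
  have hqD0' : 0 ≤ ε / D0 := by positivity
  have heq : ((1 + ε) * y - x) / D - t / D0 =
      y * (ε / D) + 2 * x * (t ^ 2 / D0) * (ε / D) - x ^ 2 * t * ((ε / D) * (ε / D0)) := by
    rw [div_sub_div _ _ hDpos.ne' hD0pos.ne']
    field_simp
    rw [hD, hD0, ht]
    ring
  rw [heq]
  have hxa : |x| ≤ 1 := abs_le.mpr ⟨hx.1.le, hx.2.le⟩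
  have hya : |y| ≤ 1 := abs_le.mpr ⟨hy.1.le, hy.2.le⟩
  have hta : |t| ≤ 2 := by rw [ht, abs_le]; constructor <;> linarith [hx.1, hx.2, hy.1, hy.2]
  have htD : t ^ 2 / D0 ≤ 1 := by rw [div_le_one hD0pos, hD0]; linarith
  have b1 : |y * (ε / D)| ≤ q := by
    rw [abs_mul, abs_of_nonneg hqD']
    exact (mul_le_of_le_one_left hqD' hya).trans hqD
  have b2 : |2 * x * (t ^ 2 / D0) * (ε / D)| ≤ 2 * q := by
    rw [abs_mul, abs_mul, abs_mul, abs_of_nonneg hqD', abs_two,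
      abs_of_nonneg (by positivity : 0 ≤ t ^ 2 / D0)]
    have : |x| * (t ^ 2 / D0) ≤ 1 := mul_le_one₀ hxa (by positivity) htD
    nlinarith
  have b3 : |x ^ 2 * t * ((ε / D) * (ε / D0))| ≤ 2 * q ^ 2 := by
    rw [abs_mul, abs_mul, abs_pow, abs_of_nonneg (mul_nonneg hqD' hqD0'), sq q]
    have h1 : ε / D * (ε / D0) ≤ q * q := mul_le_mul hqD hqD0 hqD0' hq0
    have h2 : |x| ^ 2 * |t| ≤ 2 := by
      have := pow_le_one₀ (n := 2) (abs_nonneg x) hxa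
      nlinarith [abs_nonneg t]
    exact mul_le_mul h2 h1 (mul_nonneg hqD' hqD0') two_pos.le
  calc _ ≤ |y * (ε / D) + 2 * x * (t ^ 2 / D0) * (ε / D)| + |x ^ 2 * t * ((ε / D) * (ε / D0))| :=
        abs_sub _ _
    _ ≤ q + 2 * q + 2 * q ^ 2 := add_le_add ((abs_add_le _ _).trans (add_le_add b1 b2)) b3
    _ = 3 * q + 2 * q ^ 2 := by ring
    _ ≤ _ := by gcongr

theorem tendsto_integral_conjKernel {f : ℝ → ℝ} (hf : IntegrableOn f (Ioo (-1 : ℝ) 1))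
    {x : ℝ} (hx : x ∈ Ioo (-1 : ℝ) 1) (hH : HasFiniteHilbertAt f x 0) :
    Tendsto (fun η => ∫ y in Ioo (-1 : ℝ) 1, f y * conjKernel x η y)
      (nhdsWithin 0 (Ioi 0)) (nhds 0) := by
  have hw : 0 < 1 - x ^ 2 := by nlinarith [hx.1, hx.2]
  have hsw : 0 < √(1 - x ^ 2) := Real.sqrt_pos.mpr hw
  set g : ℝ → ℝ → ℝ := fun η y => (y - x) / ((y - x) ^ 2 + (η * √(1 - x ^ 2)) ^ 2) with hg
  have hscale : Tendsto (fun η : ℝ => η * √(1 - x ^ 2)) (nhdsWithin 0 (Ioi 0))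
      (nhdsWithin 0 (Ioi 0)) := by
    refine tendsto_nhdsWithin_of_tendsto_nhds_of_eventually_within _ ?_ ?_
    · have : Tendsto (fun h : ℝ => h * √(1 - x ^ 2)) (nhds 0) (nhds (0 * √(1 - x ^ 2))) :=
        (continuous_mul_const _).tendsto 0
      rw [zero_mul] at this
      exact this.mono_left nhdsWithin_le_nhds
    · filter_upwards [self_mem_nhdsWithin] with h hh
      exact mul_pos hh hsw
  have hmain : Tendsto (fun η => ∫ y in Ioo (-1 : ℝ) 1, f y * g η y)
      (nhdsWithin 0 (Ioi 0)) (nhds 0) :=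
    (tendsto_integral_smoothed_kernel hf hH).comp hscale
  have hgm : ∀ η, Measurable (g η) := fun η => by fun_prop
  have hkm : ∀ η, Measurable (conjKernel x η) := fun η => by unfold conjKernel; fun_prop
  set C := 3 * (1 - x ^ 2)⁻¹ + 2 * ((1 - x ^ 2)⁻¹) ^ 2 with hC
  have hbd : ∀ η > 0, ∀ᵐ y ∂(volume.restrict (Ioo (-1 : ℝ) 1)),
      ‖f y * (conjKernel x η y - g η y)‖ ≤ |f y| * C := by
    intro η hη
    filter_upwards [ae_restrict_mem measurableSet_Ioo] with y hy
    rw [norm_mul]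
    exact mul_le_mul_of_nonneg_left (abs_conjKernel_sub_le hx hy hη) (abs_nonneg _)
  have hdm : ∀ η, AEStronglyMeasurable (fun y => f y * (conjKernel x η y - g η y))
      (volume.restrict (Ioo (-1 : ℝ) 1)) := fun η =>
    hf.aestronglyMeasurable.mul ((hkm η).sub (hgm η)).aestronglyMeasurable
  have hCi : Integrable (fun y => |f y| * C) (volume.restrict (Ioo (-1 : ℝ) 1)) :=
    hf.abs.mul_const C
  have hdiff : Tendsto (fun η => ∫ y in Ioo (-1 : ℝ) 1, f y * (conjKernel x η y - g η y))
      (nhdsWithin 0 (Ioi 0)) (nhds (∫ y in Ioo (-1 : ℝ) 1, f y * 0)) := by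
    refine tendsto_integral_filter_of_dominated_convergence (fun y => |f y| * C)
      (Eventually.of_forall hdm) ?_ hCi ?_
    · filter_upwards [self_mem_nhdsWithin] with η hη using hbd η hη
    · have hne : ∀ᵐ y ∂(volume.restrict (Ioo (-1 : ℝ) 1)), y ≠ x :=
        ae_restrict_of_ae (Measure.ae_ne volume x)
      filter_upwards [hne] with y hy
      refine Tendsto.const_mul _ (Tendsto.mono_left ?_ nhdsWithin_le_nhds)
      have hyx : (y - x) ^ 2 ≠ 0 := pow_ne_zero 2 (sub_ne_zero.mpr hy)
      have hcont : ContinuousAt (fun η => conjKernel x η y - g η y) 0 := by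
        refine ContinuousAt.sub ?_ ?_
        · refine ContinuousAt.div (by fun_prop) (by fun_prop) ?_
          simpa using hyx
        · refine ContinuousAt.div (by fun_prop) (by fun_prop) ?_
          simpa using hyx
      have := hcont.tendsto
      simpa [conjKernel, hg] using this
  have hsum := hdiff.add hmain
  simp only [mul_zero, integral_zero, add_zero] at hsum
  refine hsum.congr' ?_
  filter_upwards [self_mem_nhdsWithin] with η hη
  rw [← integral_add]
  · simp only [← mul_add, sub_add_cancel]
  · exact hCi.mono' (hdm η) (hbd η hη)
  · have hpos : 0 < (η * √(1 - x ^ 2)) ^ 2 := by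
      have : 0 < η := hη
      positivity
    refine hf.mul_bdd (c := 2 / (η * √(1 - x ^ 2)) ^ 2) (hgm η).aestronglyMeasurable ?_
    filter_upwards [ae_restrict_mem measurableSet_Ioo] with y hy
    rw [norm_div, Real.norm_of_nonneg (by positivity : 0 ≤ (y - x) ^ 2 + (η * √(1 - x ^ 2)) ^ 2)]
    refine div_le_div₀ two_pos.le ?_ hpos (le_add_of_nonneg_left (sq_nonneg _))
    rw [Real.norm_eq_abs, abs_le]; constructor <;> linarith [hx.1, hx.2, hy.1, hy.2]

open Polynomial.Chebyshev (T measureT)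

theorem hasSum_pow_mul_sin {r : ℝ} (hr0 : 0 ≤ r) (hr1 : r < 1) (α : ℝ) :
    HasSum (fun n : ℕ => r ^ n * Real.sin (n * α))
      (r * Real.sin α / (1 - 2 * r * Real.cos α + r ^ 2)) := by
  set z : ℂ := r * Complex.exp (α * Complex.I) with hz
  have hnorm : ‖z‖ < 1 := by
    rw [hz, norm_mul, Complex.norm_exp_ofReal_mul_I, mul_one, Complex.norm_real,
      Real.norm_of_nonneg hr0]
    exact hr1
  have h := Complex.hasSum_im (hasSum_geometric_of_norm_lt_one hnorm)
  have hre : z.re = r * Real.cos α := by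
    rw [hz, Complex.re_ofReal_mul, Complex.exp_ofReal_mul_I_re]
  have him : z.im = r * Real.sin α := by
    rw [hz, Complex.im_ofReal_mul, Complex.exp_ofReal_mul_I_im]
  convert! h using 1
  · ext n
    rw [hz, mul_pow, ← Complex.exp_nat_mul, ← Complex.ofReal_pow, Complex.im_ofReal_mul,
      ← mul_assoc, ← Complex.ofReal_natCast, ← Complex.ofReal_mul, Complex.exp_ofReal_mul_I_im]
  · rw [Complex.inv_im, Complex.normSq_apply]
    simp only [Complex.sub_re, Complex.sub_im, Complex.one_re, Complex.one_im, hre, him]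
    congr 1
    · ring
    · nlinarith [Real.sin_sq_add_cos_sq α]

theorem sq_sqrt_one_add_sq (η : ℝ) : √(1 + η ^ 2) ^ 2 = 1 + η ^ 2 :=
  Real.sq_sqrt (by positivity)

theorem sqrt_one_add_sq_sub_pos (η : ℝ) : 0 < √(1 + η ^ 2) - η := by
  rw [sub_pos]
  exact Real.lt_sqrt_of_sq_lt (by linarith)

theorem sqrt_one_add_sq_sub_lt_one {η : ℝ} (hη : 0 < η) : √(1 + η ^ 2) - η < 1 := by
  have : √(1 + η ^ 2) < 1 + η := (Real.sqrt_lt' (by linarith)).mpr (by nlinarith)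
  linarith

/-- The conjugate Poisson series expansion in Chebyshev polynomials. -/
theorem hasSum_conjKernel {η : ℝ} (hη : 0 < η) (θ φ : ℝ) (hθ : Real.sin θ ≠ 0) :
    HasSum (fun n : ℕ => (√(1 + η ^ 2) - η) ^ n * (Real.sin (n * θ) * Real.cos (n * φ)))
      (Real.sin θ * conjKernel (Real.cos θ) η (Real.cos φ) / 2) := by
  set r := √(1 + η ^ 2) - η with hr
  have hr0 : 0 < r := sqrt_one_add_sq_sub_pos η
  have hr1 : r < 1 := sqrt_one_add_sq_sub_lt_one hη
  have h := ((hasSum_pow_mul_sin hr0.le hr1 (θ + φ)).add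
    (hasSum_pow_mul_sin hr0.le hr1 (θ - φ))).div_const 2
  have hden : ∀ c : ℝ, -1 ≤ c → c ≤ 1 → 0 < 1 - 2 * r * c + r ^ 2 := fun c h1 h2 => by
    nlinarith [sq_nonneg (1 - r)]
  convert! h using 1
  · ext n
    rw [mul_add, mul_sub, Real.sin_add, Real.sin_sub]
    ring
  · have d1 := (hden _ (Real.neg_one_le_cos (θ + φ)) (Real.cos_le_one _)).ne'
    have d2 := (hden _ (Real.neg_one_le_cos (θ - φ)) (Real.cos_le_one _)).ne'
    have hrho : r ^ 2 + 1 = 2 * r * √(1 + η ^ 2) := by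
      have := sq_sqrt_one_add_sq η
      rw [hr]; nlinarith
    have hW : 1 - Real.cos θ ^ 2 = Real.sin θ ^ 2 := by
      linarith [Real.sin_sq_add_cos_sq θ]
    have d3 : (Real.cos φ - √(1 + η ^ 2) * Real.cos θ) ^ 2 + η ^ 2 * (1 - Real.cos θ ^ 2) ≠ 0 := by
      rw [hW]; positivity
    rw [conjKernel]
    have hprod : (1 - 2 * r * Real.cos (θ + φ) + r ^ 2) * (1 - 2 * r * Real.cos (θ - φ) + r ^ 2) =
        4 * r ^ 2 * ((Real.cos φ - √(1 + η ^ 2) * Real.cos θ) ^ 2 +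
          η ^ 2 * (1 - Real.cos θ ^ 2)) := by
      have e1 : 1 - 2 * r * Real.cos (θ + φ) + r ^ 2 =
        2 * r * (√(1 + η ^ 2) - Real.cos (θ + φ)) := by linear_combination hrho
      have e2 : 1 - 2 * r * Real.cos (θ - φ) + r ^ 2 =
        2 * r * (√(1 + η ^ 2) - Real.cos (θ - φ)) := by linear_combination hrho
      rw [e1, e2, Real.cos_add, Real.cos_sub]
      have := sq_sqrt_one_add_sq η
      have s1 : Real.sin θ ^ 2 = 1 - Real.cos θ ^ 2 := hW.symm
      have s2 : Real.sin φ ^ 2 = 1 - Real.cos φ ^ 2 := by linarith [Real.sin_sq_add_cos_sq φ]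
      linear_combination (4 * r ^ 2) * (1 - Real.cos θ ^ 2) * this
        - (4 * r ^ 2) * Real.sin φ ^ 2 * s1 - (4 * r ^ 2) * (1 - Real.cos θ ^ 2) * s2
    rw [div_add_div _ _ d1 d2, hprod, mul_div_assoc', div_div, div_div,
      div_eq_div_iff (by positivity) (by positivity)]
    have hnum : r * Real.sin (θ + φ) * (1 - 2 * r * Real.cos (θ - φ) + r ^ 2) +
        (1 - 2 * r * Real.cos (θ + φ) + r ^ 2) * (r * Real.sin (θ - φ)) =
        4 * r ^ 2 * (Real.sin θ * (√(1 + η ^ 2) * Real.cos φ - Real.cos θ)) := by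
      have e1 : 1 - 2 * r * Real.cos (θ + φ) + r ^ 2 =
        2 * r * (√(1 + η ^ 2) - Real.cos (θ + φ)) := by linear_combination hrho
      have e2 : 1 - 2 * r * Real.cos (θ - φ) + r ^ 2 =
        2 * r * (√(1 + η ^ 2) - Real.cos (θ - φ)) := by linear_combination hrho
      rw [e1, e2, Real.cos_add, Real.cos_sub, Real.sin_add, Real.sin_sub]
      have s2 : Real.sin φ ^ 2 = 1 - Real.cos φ ^ 2 := by linarith [Real.sin_sq_add_cos_sq φ]
      linear_combination (-(4 * r ^ 2) * Real.sin θ * Real.cos θ) * s2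
    rw [hnum]
    ring

theorem ae_measureT_of_ae_restrict {p : ℝ → Prop}
    (h : ∀ᵐ x ∂(volume.restrict (Ioo (-1 : ℝ) 1)), p x) : ∀ᵐ x ∂measureT, p x := by
  rw [Measure.restrict_congr_set Ioo_ae_eq_Ioc] at h
  exact ((withDensity_absolutelyContinuous volume _).restrict _).ae_le h

theorem isFiniteMeasure_measureT : IsFiniteMeasure measureT :=
  (integrable_const_iff_isFiniteMeasure one_ne_zero).mp
    (Polynomial.Chebyshev.integrable_measureT (f := fun _ => (1 : ℝ)) continuousOn_const)

theorem integral_measureT_eq_integral_Ioo (g : ℝ → ℝ) :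
    ∫ x, g x ∂measureT = ∫ x in Ioo (-1 : ℝ) 1, g x * (√(1 - x ^ 2))⁻¹ := by
  rw [Polynomial.Chebyshev.integral_measureT, intervalIntegral.integral_of_le (by norm_num),
    integral_Ioc_eq_integral_Ioo]
  simp only [Real.sqrt_inv]

theorem integrableOn_mul_inv_sqrt_one_sub_sq {g : ℝ → ℝ} (hg : Continuous g) :
    IntegrableOn (fun x => g x * (√(1 - x ^ 2))⁻¹) (Ioo (-1 : ℝ) 1) := by
  have h := Polynomial.Chebyshev.intervalIntegrable_sqrt_one_sub_sq_inv
  have := h.continuousOn_mul (hg.continuousOn (s := uIcc (-1) 1))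
  rw [intervalIntegrable_iff, uIoc_of_le (by norm_num)] at this
  simpa only [Real.sqrt_inv] using this.mono_set Ioo_subset_Ioc_self

theorem integral_T_measureT (n : ℤ) :
    ∫ x, (T ℝ n).eval x ∂measureT = if n = 0 then π else 0 := by
  split_ifs with h
  · rw [h, Polynomial.Chebyshev.integral_eval_T_real_measureT_zero]
  · exact Polynomial.Chebyshev.integral_eval_T_real_measureT_of_ne_zero h

theorem integral_sin_arccos_mul_measureT (n m : ℕ) :
    ∫ x, Real.sin ((n + 1 : ℕ) * Real.arccos x) * Real.sin ((m + 1 : ℕ) * Real.arccos x) ∂measureT =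
      if n = m then π / 2 else 0 := by
  have hT : ∀ k : ℤ, Integrable (fun x => (T ℝ k).eval x) measureT := fun k =>
    Polynomial.Chebyshev.integrable_measureT (Polynomial.continuous _).continuousOn
  have h1 : ∫ x, Real.sin ((n + 1 : ℕ) * Real.arccos x) *
      Real.sin ((m + 1 : ℕ) * Real.arccos x) ∂measureT =
      ∫ x, ((T ℝ ((n : ℤ) - m)).eval x - (T ℝ ((n : ℤ) + m + 2)).eval x) / 2 ∂measureT := by
    rw [Polynomial.Chebyshev.integral_measureT_eq_integral_cos,
      Polynomial.Chebyshev.integral_measureT_eq_integral_cos]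
    refine intervalIntegral.integral_congr fun θ hθ => ?_
    rw [uIcc_of_le Real.pi_pos.le] at hθ
    rw [Real.arccos_cos hθ.1 hθ.2, Polynomial.Chebyshev.T_real_cos,
      Polynomial.Chebyshev.T_real_cos]
    have e1 : (((n : ℤ) - m : ℤ) : ℝ) * θ = (n + 1 : ℕ) * θ - (m + 1 : ℕ) * θ := by
      push_cast; ring
    have e2 : (((n : ℤ) + m + 2 : ℤ) : ℝ) * θ = (n + 1 : ℕ) * θ + (m + 1 : ℕ) * θ := by
      push_cast; ring
    rw [e1, e2, Real.cos_add, Real.cos_sub]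
    ring
  have h2 : ∫ x, (T ℝ ((n : ℤ) + m + 2)).eval x ∂measureT = 0 := by
    rw [integral_T_measureT, if_neg (by omega)]
  rw [h1, integral_div, integral_sub (hT _) (hT _), h2, integral_T_measureT, sub_zero]
  by_cases h : n = m
  · simp [h]
  · rw [if_neg (by omega), if_neg h, zero_div]

theorem integral_T_mul_T_measureT (n m : ℕ) :
    ∫ x, (T ℝ (n + 1 : ℕ)).eval x * (T ℝ (m + 1 : ℕ)).eval x ∂measureT =
      if n = m then π / 2 else 0 := by
  split_ifs with h
  · rw [h]
    exact Polynomial.Chebyshev.integral_T_real_mul_self_measureT_of_ne_zero (Nat.succ_ne_zero m)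
  · exact Polynomial.Chebyshev.integral_eval_T_real_mul_eval_T_real_measureT_of_ne (by omega)

theorem abs_eval_T_le_one (n : ℤ) {x : ℝ} (hx : x ∈ Ioo (-1 : ℝ) 1) :
    |(T ℝ n).eval x| ≤ 1 := by
  rw [← Real.cos_arccos hx.1.le hx.2.le, Polynomial.Chebyshev.T_real_cos]
  exact Real.abs_cos_le_one _

theorem MeasureTheory.IntegrableOn.mul_polynomial {u : ℝ → ℝ}
    (hu : IntegrableOn u (Ioo (-1 : ℝ) 1)) (p : Polynomial ℝ) :
    IntegrableOn (fun y => u y * p.eval y) (Ioo (-1 : ℝ) 1) := by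
  obtain ⟨C, hC⟩ := isCompact_Icc.exists_bound_of_continuousOn
    (p.continuous.continuousOn (s := Icc (-1 : ℝ) 1))
  refine Integrable.mul_bdd (c := C) hu p.continuous.aestronglyMeasurable ?_
  filter_upwards [ae_restrict_mem measurableSet_Ioo] with y hy
  exact hC y (Ioo_subset_Icc_self hy)

/-- Bessel's inequality for the Chebyshev coefficients of a function in the weighted `L²` space. -/
theorem sum_sq_integral_mul_T_le {f : ℝ → ℝ} (hf : IntegrableOn f (Ioo (-1 : ℝ) 1))
    (hL2 : IntegrableOn (fun x => f x ^ 2 * √(1 - x ^ 2)) (Ioo (-1 : ℝ) 1)) (N : ℕ) :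
    ∑ n ∈ Finset.range N, (∫ y in Ioo (-1 : ℝ) 1, f y * (T ℝ (n + 1 : ℕ)).eval y) ^ 2 ≤
      π / 2 * ∫ x in Ioo (-1 : ℝ) 1, f x ^ 2 * √(1 - x ^ 2) := by
  set c : ℕ → ℝ := fun n => ∫ y in Ioo (-1 : ℝ) 1, f y * (T ℝ (n + 1 : ℕ)).eval y with hc
  set p : Polynomial ℝ :=
    ∑ n ∈ Finset.range N, Polynomial.C (2 / π * c n) * T ℝ (n + 1 : ℕ) with hp
  have heval : ∀ y, p.eval y =
      ∑ n ∈ Finset.range N, 2 / π * c n * (T ℝ (n + 1 : ℕ)).eval y := fun y => by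
    simp [hp, Polynomial.eval_finsetSum]
  have hfp : ∫ y in Ioo (-1 : ℝ) 1, f y * p.eval y =
      2 / π * ∑ n ∈ Finset.range N, c n ^ 2 := by
    have : ∀ y, f y * p.eval y = ∑ n ∈ Finset.range N,
        2 / π * c n * (f y * (T ℝ (n + 1 : ℕ)).eval y) := fun y => by
      rw [heval, Finset.mul_sum]
      exact Finset.sum_congr rfl fun _ _ => by ring
    simp only [this]
    rw [integral_finsetSum _ fun n _ => (hf.mul_polynomial _).const_mul _, Finset.mul_sum]
    refine Finset.sum_congr rfl fun n _ => ?_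
    rw [integral_const_mul, sq, ← mul_assoc]
  have hpp : ∫ y in Ioo (-1 : ℝ) 1, p.eval y ^ 2 * (√(1 - y ^ 2))⁻¹ =
      2 / π * ∑ n ∈ Finset.range N, c n ^ 2 := by
    rw [← integral_measureT_eq_integral_Ioo (fun y => p.eval y ^ 2)]
    have : ∀ y, p.eval y ^ 2 = ∑ n ∈ Finset.range N, ∑ m ∈ Finset.range N,
        2 / π * c n * (2 / π * c m) *
          ((T ℝ (n + 1 : ℕ)).eval y * (T ℝ (m + 1 : ℕ)).eval y) := fun y => by
      rw [heval, sq, Finset.sum_mul_sum]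
      exact Finset.sum_congr rfl fun _ _ => Finset.sum_congr rfl fun _ _ => by ring
    simp only [this]
    have hi : ∀ n m : ℕ, Integrable (fun y => 2 / π * c n * (2 / π * c m) *
          ((T ℝ (n + 1 : ℕ)).eval y * (T ℝ (m + 1 : ℕ)).eval y)) measureT := fun n m =>
      Polynomial.Chebyshev.integrable_measureT (Continuous.continuousOn (by fun_prop))
    rw [integral_finsetSum _ fun n _ => integrable_finsetSum _ fun m _ => hi n m,
      Finset.mul_sum]
    refine Finset.sum_congr rfl fun n hn => ?_
    rw [integral_finsetSum _ fun m _ => hi n m]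
    simp only [integral_const_mul, integral_T_mul_T_measureT]
    simp only [mul_ite, mul_zero, Finset.sum_ite_eq, if_pos hn]
    field_simp
  have hnonneg : 0 ≤ ∫ y in Ioo (-1 : ℝ) 1, (f y ^ 2 * √(1 - y ^ 2) - 2 * (f y * p.eval y) +
      p.eval y ^ 2 * (√(1 - y ^ 2))⁻¹) := by
    refine setIntegral_nonneg measurableSet_Ioo fun y hy => ?_
    have hw : 0 < √(1 - y ^ 2) := Real.sqrt_pos.mpr (by nlinarith [hy.1, hy.2])
    have : f y ^ 2 * √(1 - y ^ 2) - 2 * (f y * p.eval y) + p.eval y ^ 2 * (√(1 - y ^ 2))⁻¹ =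
        (f y * √(1 - y ^ 2) - p.eval y) ^ 2 * (√(1 - y ^ 2))⁻¹ := by
      field_simp
      ring
    rw [this]
    positivity
  have hp2 : Continuous fun y => p.eval y ^ 2 := p.continuous.pow 2
  have hsub : IntegrableOn (fun y => f y ^ 2 * √(1 - y ^ 2) - 2 * (f y * p.eval y))
      (Ioo (-1 : ℝ) 1) := hL2.sub ((hf.mul_polynomial p).const_mul 2)
  rw [integral_add hsub (integrableOn_mul_inv_sqrt_one_sub_sq hp2),
    integral_sub hL2 ((hf.mul_polynomial p).const_mul 2), integral_const_mul, hfp, hpp] at hnonneg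
  have hpi := Real.pi_pos
  have : 2 / π * ∑ n ∈ Finset.range N, c n ^ 2 ≤
      ∫ x in Ioo (-1 : ℝ) 1, f x ^ 2 * √(1 - x ^ 2) := by linarith
  calc ∑ n ∈ Finset.range N, c n ^ 2 = π / 2 * (2 / π * ∑ n ∈ Finset.range N, c n ^ 2) := by
        field_simp
    _ ≤ _ := mul_le_mul_of_nonneg_left this (by positivity)

/-- A function on `(-1, 1)` orthogonal to all Chebyshev polynomials vanishes almost everywhere. -/
theorem ae_eq_zero_of_integral_mul_T_eq_zero {u : ℝ → ℝ}
    (hu : IntegrableOn u (Ioo (-1 : ℝ) 1))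
    (h : ∀ n : ℕ, ∫ y in Ioo (-1 : ℝ) 1, u y * (T ℝ n).eval y = 0) :
    ∀ᵐ x ∂(volume.restrict (Ioo (-1 : ℝ) 1)), u x = 0 := by
  have hmono : ∀ (k : ℕ) (n : ℤ),
      ∫ y in Ioo (-1 : ℝ) 1, u y * (Polynomial.X ^ k * T ℝ n).eval y = 0 := by
    intro k
    induction k with
    | zero =>
      intro n
      rw [← Polynomial.Chebyshev.T_natAbs]
      simpa using h n.natAbs
    | succ k ih =>
      intro n
      have hrec : ∀ y, u y * (Polynomial.X ^ (k + 1) * T ℝ n).eval y =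
          (u y * (Polynomial.X ^ k * T ℝ (n + 1)).eval y +
            u y * (Polynomial.X ^ k * T ℝ (n - 1)).eval y) / 2 := fun y => by
        rw [Polynomial.Chebyshev.T_add_one]
        simp only [Polynomial.eval_mul, Polynomial.eval_pow, Polynomial.eval_X,
          Polynomial.eval_sub, Polynomial.eval_ofNat]
        ring
      simp only [hrec]
      rw [integral_div, integral_add (hu.mul_polynomial _) (hu.mul_polynomial _), ih, ih]
      norm_num
  have hpoly : ∀ p : Polynomial ℝ, ∫ y in Ioo (-1 : ℝ) 1, u y * p.eval y = 0 := by
    intro p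
    induction p using Polynomial.induction_on' with
    | add p q hp hq =>
      simp only [Polynomial.eval_add, mul_add]
      rw [integral_add (hu.mul_polynomial _) (hu.mul_polynomial _), hp, hq, add_zero]
    | monomial k a =>
      have h0 := hmono k 0
      simp only [Polynomial.Chebyshev.T_zero, mul_one, Polynomial.eval_pow,
        Polynomial.eval_X] at h0
      simp only [Polynomial.eval_monomial, mul_left_comm _ a, integral_const_mul, h0, mul_zero]
  rw [ae_restrict_iff' measurableSet_Ioo]
  refine isOpen_Ioo.ae_eq_zero_of_integral_contDiff_smul_eq_zero hu.locallyIntegrableOn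
    fun g hg _ hgs => ?_
  have hgint : ∫ x, g x • u x = ∫ x in Ioo (-1 : ℝ) 1, u x * g x := by
    rw [← setIntegral_eq_integral_of_forall_compl_eq_zero (s := Ioo (-1 : ℝ) 1)]
    · simp only [smul_eq_mul, mul_comm]
    · intro x hx
      rw [image_eq_zero_of_notMem_tsupport fun hx' => hx (hgs hx'), zero_smul]
  rw [hgint]
  have hgi : IntegrableOn (fun y => u y * g y) (Ioo (-1 : ℝ) 1) := by
    obtain ⟨C, hC⟩ := isCompact_Icc.exists_bound_of_continuousOn
      (hg.continuous.continuousOn (s := Icc (-1 : ℝ) 1))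
    refine Integrable.mul_bdd (c := C) hu hg.continuous.aestronglyMeasurable ?_
    filter_upwards [ae_restrict_mem measurableSet_Ioo] with y hy
    exact hC y (Ioo_subset_Icc_self hy)
  by_contra hne
  set I := ∫ x in Ioo (-1 : ℝ) 1, |u x| with hI
  have hI0 : 0 ≤ I := integral_nonneg fun _ => abs_nonneg _
  have hpos := abs_pos.mpr hne
  obtain ⟨p, hp⟩ := exists_polynomial_near_of_continuousOn (-1) 1 g hg.continuous.continuousOn
    (|∫ x in Ioo (-1 : ℝ) 1, u x * g x| / (I + 1)) (by positivity)
  set δ := |∫ x in Ioo (-1 : ℝ) 1, u x * g x| / (I + 1) with hδ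
  have hle : |∫ x in Ioo (-1 : ℝ) 1, u x * g x| ≤ I * δ := by
    have h1 : ∫ x in Ioo (-1 : ℝ) 1, u x * g x =
        ∫ x in Ioo (-1 : ℝ) 1, (u x * g x - u x * p.eval x) := by
      rw [integral_sub hgi (hu.mul_polynomial p), hpoly, sub_zero]
    rw [h1, hI, ← integral_mul_const]
    refine abs_integral_le_integral_abs.trans (setIntegral_mono_on
      (hgi.sub (hu.mul_polynomial p)).abs (hu.abs.mul_const δ) measurableSet_Ioo fun x hx => ?_)
    rw [← mul_sub, abs_mul, abs_sub_comm]
    exact mul_le_mul_of_nonneg_left (hp x (Ioo_subset_Icc_self hx)).le (abs_nonneg _)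
  have hlt : I * δ < |∫ x in Ioo (-1 : ℝ) 1, u x * g x| := by
    rw [hδ, mul_div_assoc', div_lt_iff₀ (by positivity)]
    nlinarith
  linarith

theorem integrableOn_of_weighted_sq {f : ℝ → ℝ}
    (hmeas : AEStronglyMeasurable f (volume.restrict (Ioo (-1 : ℝ) 1)))
    (hL2 : IntegrableOn (fun x => f x ^ 2 * √(1 - x ^ 2)) (Ioo (-1 : ℝ) 1)) :
    IntegrableOn f (Ioo (-1 : ℝ) 1) := by
  have h1 := integrableOn_mul_inv_sqrt_one_sub_sq (g := fun _ => (1 : ℝ)) continuous_const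
  refine (hL2.add h1).mono' hmeas ?_
  filter_upwards [ae_restrict_mem measurableSet_Ioo] with y hy
  have hw : 0 < √(1 - y ^ 2) := Real.sqrt_pos.mpr (by nlinarith [hy.1, hy.2])
  have h2 : f y ^ 2 * √(1 - y ^ 2) + 1 * (√(1 - y ^ 2))⁻¹ - |f y| =
      ((|f y| * √(1 - y ^ 2) - 1) ^ 2 + |f y| * √(1 - y ^ 2)) * (√(1 - y ^ 2))⁻¹ := by
    rw [← sq_abs (f y)]
    field_simp
    ring
  have h3 : 0 ≤ ((|f y| * √(1 - y ^ 2) - 1) ^ 2 + |f y| * √(1 - y ^ 2)) * (√(1 - y ^ 2))⁻¹ := by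
    positivity
  rw [Real.norm_eq_abs]
  exact sub_nonneg.mp (h2 ▸ h3)

theorem hasSum_chebyshev_conjugate {f : ℝ → ℝ} (hf : IntegrableOn f (Ioo (-1 : ℝ) 1))
    {x : ℝ} (hx : x ∈ Ioo (-1 : ℝ) 1) {η : ℝ} (hη : 0 < η) :
    HasSum (fun n : ℕ => (√(1 + η ^ 2) - η) ^ n *
        (∫ y in Ioo (-1 : ℝ) 1, f y * (T ℝ n).eval y) * Real.sin (n * Real.arccos x))
      (√(1 - x ^ 2) / 2 * ∫ y in Ioo (-1 : ℝ) 1, f y * conjKernel x η y) := by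
  set r := √(1 + η ^ 2) - η with hr
  have hr0 : 0 < r := sqrt_one_add_sq_sub_pos η
  have hr1 : r < 1 := sqrt_one_add_sq_sub_lt_one hη
  have hsin : Real.sin (Real.arccos x) = √(1 - x ^ 2) := Real.sin_arccos x
  have hw : 0 < √(1 - x ^ 2) := Real.sqrt_pos.mpr (by nlinarith [hx.1, hx.2])
  have h := hasSum_integral_of_dominated_convergence
    (μ := volume.restrict (Ioo (-1 : ℝ) 1))
    (F := fun (n : ℕ) y => r ^ n * Real.sin (n * Real.arccos x) * (f y * (T ℝ n).eval y))
    (f := fun y => √(1 - x ^ 2) / 2 * (f y * conjKernel x η y))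
    (fun n y => r ^ n * |f y|)
    (fun n => ((hf.mul_polynomial _).const_mul _).aestronglyMeasurable) ?_ ?_ ?_ ?_
  · rw [integral_const_mul] at h
    convert! h using 2 with n
    rw [integral_const_mul]
    ring
  · intro n
    filter_upwards [ae_restrict_mem measurableSet_Ioo] with y hy
    rw [norm_mul, norm_mul, norm_mul, Real.norm_of_nonneg (pow_nonneg hr0.le n)]
    simp only [Real.norm_eq_abs]
    have h1 : r ^ n * |Real.sin (n * Real.arccos x)| ≤ r ^ n :=
      mul_le_of_le_one_right (pow_nonneg hr0.le n) (Real.abs_sin_le_one _)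
    have h2 : |f y| * |(T ℝ n).eval y| ≤ |f y| :=
      mul_le_of_le_one_right (abs_nonneg _) (abs_eval_T_le_one _ hy)
    exact mul_le_mul h1 h2 (by positivity) (by positivity)
  · exact Eventually.of_forall fun y => (summable_geometric_of_lt_one hr0.le hr1).mul_right _
  · simp only [tsum_mul_right]
    exact hf.abs.const_mul _
  · filter_upwards [ae_restrict_mem measurableSet_Ioo] with y hy
    have hk := (hasSum_conjKernel hη (Real.arccos x) (Real.arccos y) (by rw [hsin]; exact hw.ne'))
    rw [hsin, Real.cos_arccos hx.1.le hx.2.le, Real.cos_arccos hy.1.le hy.2.le] at hk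
    convert! hk.mul_left (f y) using 1
    · ext n
      have : (T ℝ (n : ℤ)).eval y = Real.cos (n * Real.arccos y) := by
        conv_lhs => rw [← Real.cos_arccos hy.1.le hy.2.le, Polynomial.Chebyshev.T_real_cos]
        simp
      rw [this]
      ring
    · ring

theorem integral_mul_T_succ_eq_zero {f : ℝ → ℝ} (hf : IntegrableOn f (Ioo (-1 : ℝ) 1))
    (hL2 : IntegrableOn (fun x => f x ^ 2 * √(1 - x ^ 2)) (Ioo (-1 : ℝ) 1))
    (hH : ∀ᵐ x ∂(volume.restrict (Ioo (-1 : ℝ) 1)), HasFiniteHilbertAt f x 0) (n : ℕ) :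
    ∫ y in Ioo (-1 : ℝ) 1, f y * (T ℝ (n + 1 : ℕ)).eval y = 0 := by
  have := isFiniteMeasure_measureT
  have hcont : ContinuousAt (fun η : ℝ => √(1 + η ^ 2) - η) 0 := by fun_prop
  have hr : Tendsto (fun η : ℝ => √(1 + η ^ 2) - η) (nhdsWithin 0 (Ioi 0)) (nhds 1) := by
    have := hcont.tendsto
    simp only [ne_eq, OfNat.ofNat_ne_zero, not_false_eq_true, zero_pow, add_zero, Real.sqrt_one,
      sub_zero] at this
    exact this.mono_left nhdsWithin_le_nhds
  refine coeff_eq_zero_of_ae_tendsto_abel (ν := measureT) (l := nhdsWithin (0 : ℝ) (Ioi 0))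
    (e := fun n x => Real.sin ((n + 1 : ℕ) * Real.arccos x))
    (r := fun η => √(1 + η ^ 2) - η) (κ := π / 2)
    (a := fun n => ∫ y in Ioo (-1 : ℝ) 1, f y * (T ℝ (n + 1 : ℕ)).eval y)
    (fun n => Real.measurable_sin.comp (Real.measurable_arccos.const_mul _))
    (fun n x => Real.abs_sin_le_one _) (by positivity)
    integral_sin_arccos_mul_measureT (sum_sq_integral_mul_T_le hf hL2)
    (fun η => (sqrt_one_add_sq_sub_pos η).le) ?_ hr (ae_measureT_of_ae_restrict ?_) n
  · filter_upwards [self_mem_nhdsWithin] with η hη using sqrt_one_add_sq_sub_lt_one hη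
  · filter_upwards [hH, ae_restrict_mem measurableSet_Ioo] with x hx hxI
    have hlim := ((tendsto_integral_conjKernel hf hxI hx).const_mul (√(1 - x ^ 2) / 2))
    have h2 := (hr.inv₀ one_ne_zero).mul hlim
    rw [mul_zero, mul_zero] at h2
    refine h2.congr' ?_
    filter_upwards [self_mem_nhdsWithin] with η hη
    have hs := hasSum_chebyshev_conjugate hf hxI (mem_Ioi.mp hη)
    have hr0 := sqrt_one_add_sq_sub_pos η
    rw [← hasSum_nat_add_iff' 1] at hs
    simp only [Finset.range_one, Finset.sum_singleton, Nat.cast_zero, zero_mul, Real.sin_zero,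
      mul_zero, sub_zero] at hs
    rw [← (hs.mul_left (√(1 + η ^ 2) - η)⁻¹).tsum_eq]
    refine tsum_congr fun n => ?_
    field_simp
    ring

/-- **Tricomi's theorem, reformulated.** If `f(x)(1-x²)^{1/4} ∈ L²(-1,1)` and the
finite Hilbert transform of `f` vanishes a.e. on `(-1,1)`, then `x ↦ f(x)√(1-x²)`
is a.e. equal to a constant on `(-1,1)`. -/
theorem tricomi_constant (f : ℝ → ℝ)
    (hmeas : AEStronglyMeasurable f (volume.restrict (Ioo (-1 : ℝ) 1)))
    (hL2 : IntegrableOn (fun x => f x ^ 2 * Real.sqrt (1 - x ^ 2)) (Ioo (-1 : ℝ) 1))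
    (hH : ∀ᵐ x ∂(volume.restrict (Ioo (-1 : ℝ) 1)), HasFiniteHilbertAt f x 0) :
    ∃ c : ℝ, ∀ᵐ x ∂(volume.restrict (Ioo (-1 : ℝ) 1)),
      f x * Real.sqrt (1 - x ^ 2) = c := by
  have hf := integrableOn_of_weighted_sq hmeas hL2
  set c := (∫ y in Ioo (-1 : ℝ) 1, f y) / π with hc
  have hw := integrableOn_mul_inv_sqrt_one_sub_sq (g := fun _ => c) continuous_const
  refine ⟨c, ?_⟩
  have hu := ae_eq_zero_of_integral_mul_T_eq_zero
    (u := fun y => f y - c * (√(1 - y ^ 2))⁻¹) (hf.sub hw) fun n => ?_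
  · filter_upwards [hu, ae_restrict_mem measurableSet_Ioo] with x hx hxI
    have hpos : 0 < √(1 - x ^ 2) := Real.sqrt_pos.mpr (by nlinarith [hxI.1, hxI.2])
    rw [sub_eq_zero.mp hx, inv_mul_cancel_right₀ hpos.ne']
  · have h1 : ∫ y in Ioo (-1 : ℝ) 1, c * (√(1 - y ^ 2))⁻¹ * (T ℝ n).eval y =
        if n = 0 then c * π else 0 := by
      have h2 : ∀ y : ℝ, c * (√(1 - y ^ 2))⁻¹ * (T ℝ n).eval y =
          c * ((T ℝ n).eval y * (√(1 - y ^ 2))⁻¹) := fun y => by ring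
      simp only [h2]
      rw [integral_const_mul, ← integral_measureT_eq_integral_Ioo (fun y => (T ℝ n).eval y),
        integral_T_measureT]
      simp
    simp only [sub_mul]
    rw [integral_sub (hf.mul_polynomial _) (hw.mul_polynomial _), h1]
    cases n with
    | zero =>
      simp only [Nat.cast_zero, Polynomial.Chebyshev.T_zero, Polynomial.eval_one, mul_one, if_true]
      rw [hc, div_mul_cancel₀ _ Real.pi_ne_zero, sub_self]
    | succ n =>
      rw [integral_mul_T_succ_eq_zero hf hL2 hH, if_neg (Nat.succ_ne_zero n), sub_zero]
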